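/- (Ehlich–Zeller / Rivlin–Cheney) Let p be a univariate real polynomial of degree d such that b₁ ≤ p(i) ≤ b₂ for every integer 0 ≤ i ≤ n, and |p'(x)| ≥ c for some real 0 ≤ x ≤ n, where c > 0. Then d ≥ √(cn/(c + b₂ − b₁)). -/

import Mathlib

open Polynomial in
/-- quotients `(u^m - v^m)/(u-v)` for `u, v = cos (t ± s)` as polynomials in `cos s` -/
noncomputable def mkW (a b : ℝ) : ℕ → Polynomial ℝ
  | 0 => 0
  | 1 => 1
  | (m + 2) => C (2 * a) * X * mkW a b (m + 1) - (X ^ 2 - C (b ^ 2)) * mkW a b m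

open Polynomial in
lemma mkW_natDegree (a b : ℝ) (m : ℕ) :
    (mkW a b (m + 1)).natDegree ≤ m ∧ (mkW a b (m + 2)).natDegree ≤ m + 1 := by
  induction m with
  | zero =>
    refine ⟨by simp [mkW], ?_⟩
    have : mkW a b 2 = C (2 * a) * X := by simp [mkW]
    rw [zero_add, this]
    compute_degree
  | succ m ih =>
    refine ⟨ih.2, ?_⟩
    rw [mkW]
    refine (natDegree_sub_le _ _).trans (max_le ?_ ?_)
    · refine natDegree_mul_le.trans ?_
      have : (C (2 * a) * X : ℝ[X]).natDegree ≤ 1 := by compute_degree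
      have : (mkW a b (m + 1 + 1)).natDegree ≤ m + 1 := ih.2
      omega
    · refine natDegree_mul_le.trans ?_
      have : (X ^ 2 - C (b ^ 2) : ℝ[X]).natDegree ≤ 2 := by compute_degree
      have := ih.1
      omega

open Polynomial in
lemma mkW_eval (a b c s : ℝ) (h : a ^ 2 + b ^ 2 = 1) (h' : c ^ 2 + s ^ 2 = 1) (m : ℕ) :
    ((a * c - b * s) ^ m - (a * c + b * s) ^ m = -2 * b * s * (mkW a b m).eval c) ∧
    ((a * c - b * s) ^ (m + 1) - (a * c + b * s) ^ (m + 1)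
      = -2 * b * s * (mkW a b (m + 1)).eval c) := by
  induction m with
  | zero => constructor <;> simp [mkW]; ring
  | succ m ih =>
    refine ⟨ih.2, ?_⟩
    obtain ⟨h1, h2⟩ := ih
    simp only [mkW, eval_sub, eval_mul, eval_C, eval_X, eval_pow]
    have e : c ^ 2 - b ^ 2 = (a * c - b * s) * (a * c + b * s) := by
      linear_combination (-c ^ 2) * h + (b ^ 2) * h'
    rw [e]
    linear_combination (2 * a * c) * h2 - (a * c - b * s) * (a * c + b * s) * h1

open Polynomial in
lemma mkW_one (a b : ℝ) (h : a ^ 2 + b ^ 2 = 1) (m : ℕ) :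
    (mkW a b (m + 1)).eval 1 = (m + 1) * a ^ m ∧
    (mkW a b (m + 2)).eval 1 = (m + 2) * a ^ (m + 1) := by
  induction m with
  | zero => constructor <;> simp [mkW]
  | succ m ih =>
    refine ⟨by rw [ih.2]; push_cast; ring, ?_⟩
    rw [mkW]
    simp only [eval_sub, eval_mul, eval_C, eval_X, eval_pow]
    rw [ih.1, ih.2]
    push_cast
    have : (1 : ℝ) ^ 2 - b ^ 2 = a ^ 2 := by linarith
    rw [this]; ring

open Polynomial in
lemma exists_V (P : ℝ[X]) (n : ℕ) (hn : 0 < n) (hP : P.natDegree ≤ n) (t : ℝ) :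
    ∃ V : ℝ[X], V.degree < n ∧
      (∀ s, P.eval (Real.cos (t + s)) - P.eval (Real.cos (t - s))
        = 2 * (Real.sin s * V.eval (Real.cos s))) ∧
      V.eval 1 = - Real.sin t * (derivative P).eval (Real.cos t) := by
  set a := Real.cos t
  set b := Real.sin t
  have hab : a ^ 2 + b ^ 2 = 1 := Real.cos_sq_add_sin_sq t
  refine ⟨∑ m ∈ Finset.range (n + 1), C (-b * P.coeff m) * mkW a b m, ?_, ?_, ?_⟩
  · refine (degree_sum_le _ _).trans_lt ?_
    refine (Finset.sup_lt_iff (WithBot.bot_lt_coe n)).mpr ?_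
    intro m hm
    rw [Finset.mem_range] at hm
    rcases m with _ | m
    · simp [mkW]
    · refine lt_of_le_of_lt (degree_le_of_natDegree_le
        ((natDegree_C_mul_le _ _).trans (mkW_natDegree a b m).1)) ?_
      exact WithBot.coe_lt_coe.mpr (by omega : m < n)
  · intro s
    rw [eval_eq_sum_range' (Nat.lt_succ_of_le hP), eval_eq_sum_range' (Nat.lt_succ_of_le hP),
      eval_finsetSum, Finset.mul_sum, Finset.mul_sum, ← Finset.sum_sub_distrib]
    refine Finset.sum_congr rfl fun m _ => ?_
    rw [Real.cos_add, Real.cos_sub, eval_mul, eval_C]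
    have := (mkW_eval a b (Real.cos s) (Real.sin s) hab (Real.cos_sq_add_sin_sq s) m).1
    linear_combination (P.coeff m) * this
  · rw [eval_finsetSum, derivative_eval, P.sum_over_range' (by simp) (n + 1) (by omega),
      Finset.mul_sum]
    refine Finset.sum_congr rfl fun m _ => ?_
    rw [eval_mul, eval_C]
    rcases m with _ | m
    · simp [mkW]
    · rw [(mkW_one a b hab m).1]; push_cast; simp; ring

/-- Chebyshev zeros -/
noncomputable def znode (n i : ℕ) : ℝ := Real.cos ((2 * i + 1) * Real.pi / (2 * n))

lemma zangle_mem {n i : ℕ} (hi : i < n) :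
    (2 * i + 1) * Real.pi / (2 * n) ∈ Set.Ioo 0 Real.pi := by
  have hn : (0 : ℝ) < n := by exact_mod_cast (by omega : 0 < n)
  have : (i : ℝ) + 1 ≤ n := by exact_mod_cast hi
  refine ⟨by positivity, ?_⟩
  rw [div_lt_iff₀ (by positivity)]
  nlinarith [Real.pi_pos]

lemma znode_lt {n i j : ℕ} (hj : j < n) (hij : i < j) : znode n j < znode n i := by
  have hn : (0 : ℝ) < n := by exact_mod_cast (by omega : 0 < n)
  have h1 := zangle_mem (hij.trans hj)
  have h2 := zangle_mem hj
  refine Real.strictAntiOn_cos ⟨h1.1.le, h1.2.le⟩ ⟨h2.1.le, h2.2.le⟩ ?_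
  have : (i : ℝ) < j := by exact_mod_cast hij
  have := Real.pi_pos
  gcongr

lemma znode_inj (n : ℕ) : Set.InjOn (znode n) (Finset.range n) := by
  intro i hi j hj h
  simp at hi hj
  rcases lt_trichotomy i j with h' | h' | h'
  · exact absurd h (znode_lt hj h').ne'
  · exact h'
  · exact absurd h (znode_lt hi h').ne

lemma zprod_pos {n i : ℕ} (hi : i < n) :
    0 < (-1) ^ i * ∏ j ∈ (Finset.range n).erase i, (znode n i - znode n j) := by
  have h₁ : 0 < ∏ j ∈ Finset.range i, ((-1) * (znode n i - znode n j)) :=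
    Finset.prod_pos (fun j hj => by
      have := znode_lt hi (Finset.mem_range.mp hj)
      linarith)
  have h₂ : 0 < ∏ j ∈ Finset.Ioo i n, (znode n i - znode n j) :=
    Finset.prod_pos (fun j hj => by
      have hj := Finset.mem_Ioo.mp hj
      have := znode_lt hj.2 hj.1
      linarith)
  have h := mul_pos h₁ h₂
  rw [Finset.prod_mul_distrib, Finset.prod_const, Finset.card_range, mul_assoc,
    ← Finset.prod_union] at h
  · have e : (Finset.range n).erase i = Finset.range i ∪ Finset.Ioo i n := by
      ext j; simp; omega
    rw [e]; exact h
  · rw [Finset.disjoint_left]; intro j; simp; omega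

open Polynomial in
lemma basis_sign {n i : ℕ} (hi : i < n) {x : ℝ} (hx : znode n 0 ≤ x) :
    0 ≤ (-1) ^ i * (Lagrange.basis (Finset.range n) (znode n) i).eval x := by
  have h0 := zprod_pos hi
  have h1 : 0 ≤ ∏ j ∈ (Finset.range n).erase i, (x - znode n j) :=
    Finset.prod_nonneg (fun j hj => by
      have hj' : j < n := by simp at hj; exact hj.2
      rcases Nat.eq_zero_or_pos j with rfl | hj0
      · linarith
      · have := znode_lt hj' hj0; linarith)
  have e : (Lagrange.basis (Finset.range n) (znode n) i).eval x =
      (∏ j ∈ (Finset.range n).erase i, (x - znode n j)) /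
      (∏ j ∈ (Finset.range n).erase i, (znode n i - znode n j)) := by
    rw [Lagrange.basis, eval_prod, ← Finset.prod_div_distrib]
    refine Finset.prod_congr rfl fun j _ => ?_
    simp [Lagrange.basisDivisor]; ring
  rw [e]
  have e2 : ∀ A B : ℝ, (-1) ^ i * (A / B) = A / ((-1) ^ i * B) := by
    intro A B
    rcases neg_one_pow_eq_or ℝ i with h | h <;> rw [h] <;> ring
  rw [e2]
  exact div_nonneg h1 h0.le

open Polynomial in
lemma U_znode {n i : ℕ} (hi : i < n) :
    (Chebyshev.U ℝ ((n : ℤ) - 1)).eval (znode n i) =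
      (-1) ^ i / Real.sin ((2 * i + 1) * Real.pi / (2 * n)) := by
  have hn : (n : ℝ) ≠ 0 := by exact_mod_cast (by omega : n ≠ 0)
  have hs := Real.sin_pos_of_mem_Ioo (zangle_mem hi)
  rw [eq_div_iff hs.ne', znode, Chebyshev.U_real_cos]
  have : ((((n : ℤ) - 1 : ℤ) : ℝ) + 1) * ((2 * i + 1) * Real.pi / (2 * n))
      = Real.pi / 2 + i * Real.pi := by
    push_cast; field_simp; ring
  rw [this, Real.sin_add_nat_mul_pi]; simp

open Polynomial in
lemma U_le {n : ℕ} (hn : 0 < n) {x : ℝ} (hx : |x| ≤ 1) :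
    (Chebyshev.U ℝ ((n : ℤ) - 1)).eval x ≤ n := by
  have h := Chebyshev.abs_iterate_derivative_T_real_le n 1 hx
  have hn' : (0 : ℝ) < n := by exact_mod_cast hn
  simp only [Function.iterate_one, Chebyshev.T_derivative_eq_U, eval_mul,
    Chebyshev.U_eval_one] at h
  simp at h
  have := le_of_mul_le_mul_left h hn'
  exact (le_abs_self _).trans this

open Polynomial in
lemma schur_edge {n : ℕ} (hn : 0 < n) (V : ℝ[X]) (hV : V.degree < n) (M : ℝ)
    (h : ∀ s, |Real.sin s * V.eval (Real.cos s)| ≤ M) {x : ℝ} (hx : znode n 0 ≤ x)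
    (hx1 : |x| ≤ 1) : |V.eval x| ≤ M * n := by
  have hM : 0 ≤ M := (abs_nonneg _).trans (h 0)
  have key : ∀ Q : ℝ[X], Q.degree < n → Q.eval x =
      ∑ i ∈ Finset.range n, Q.eval (znode n i) *
        (Lagrange.basis (Finset.range n) (znode n) i).eval x := by
    intro Q hQ
    conv_lhs => rw [Lagrange.eq_interpolate (znode_inj n) (f := Q) (by simpa using hQ)]
    rw [Lagrange.interpolate_apply, eval_finsetSum]
    simp
  have hU : (Chebyshev.U ℝ ((n : ℤ) - 1)).degree < n := by
    obtain ⟨k, rfl⟩ : ∃ k, n = k + 1 := ⟨n - 1, by omega⟩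
    have : (((k + 1 : ℕ) : ℤ) - 1) = (k : ℤ) := by push_cast; ring
    rw [this, Chebyshev.degree_U_natCast]
    exact_mod_cast Nat.lt_succ_self k
  calc |V.eval x| ≤ ∑ i ∈ Finset.range n, |V.eval (znode n i) *
        (Lagrange.basis (Finset.range n) (znode n) i).eval x| := by
          rw [key V hV]; exact Finset.abs_sum_le_sum_abs _ _
    _ ≤ ∑ i ∈ Finset.range n, M * ((Chebyshev.U ℝ ((n : ℤ) - 1)).eval (znode n i) *
        (Lagrange.basis (Finset.range n) (znode n) i).eval x) := by
          refine Finset.sum_le_sum fun i hi => ?_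
          have hi' := Finset.mem_range.mp hi
          have hs := Real.sin_pos_of_mem_Ioo (zangle_mem hi')
          have hb := basis_sign hi' hx
          rw [U_znode hi']
          have h2 := h ((2 * i + 1) * Real.pi / (2 * n))
          rw [abs_mul, abs_of_pos hs] at h2
          change _ * |V.eval (znode n i)| ≤ M at h2
          have h3 : |V.eval (znode n i)| ≤ M / Real.sin ((2 * i + 1) * Real.pi / (2 * n)) := by
            rw [le_div_iff₀ hs]; linarith
          have h4 : |(Lagrange.basis (Finset.range n) (znode n) i).eval x| =
              (-1) ^ i * (Lagrange.basis (Finset.range n) (znode n) i).eval x := by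
            rw [← abs_of_nonneg hb, abs_mul]; simp
          rw [abs_mul, h4]
          calc _ ≤ M / Real.sin ((2 * i + 1) * Real.pi / (2 * n)) *
                ((-1) ^ i * (Lagrange.basis (Finset.range n) (znode n) i).eval x) :=
                mul_le_mul_of_nonneg_right h3 hb
            _ = _ := by ring
    _ = M * (Chebyshev.U ℝ ((n : ℤ) - 1)).eval x := by rw [key _ hU, Finset.mul_sum]
    _ ≤ M * n := mul_le_mul_of_nonneg_left (U_le hn hx1) hM

open Polynomial in
lemma bernstein_ineq {n : ℕ} (hn : 0 < n) (P : ℝ[X]) (hP : P.natDegree ≤ n) (M : ℝ)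
    (h : ∀ x, |x| ≤ 1 → |P.eval x| ≤ M) (t : ℝ) :
    |Real.sin t * (derivative P).eval (Real.cos t)| ≤ M * n := by
  obtain ⟨V, hV, h1, h2⟩ := exists_V P n hn hP t
  have := schur_edge hn V hV M (fun s => by
    have a1 := abs_le.mp (h _ (Real.abs_cos_le_one (t + s)))
    have a2 := abs_le.mp (h _ (Real.abs_cos_le_one (t - s)))
    have := h1 s
    rw [abs_le]; constructor <;> linarith) (x := 1) (Real.cos_le_one _) (by simp)
  rw [h2] at this
  simpa [abs_mul] using this

open Polynomial in
lemma markov_pos {n : ℕ} (hn : 0 < n) (P : ℝ[X]) (hP : P.natDegree ≤ n) (M : ℝ)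
    (h : ∀ x, |x| ≤ 1 → |P.eval x| ≤ M) {x : ℝ} (hx0 : 0 ≤ x) (hx : x ≤ 1) :
    |(derivative P).eval x| ≤ M * n ^ 2 := by
  have hn' : (0 : ℝ) < n := by exact_mod_cast hn
  have hM : 0 ≤ M := (abs_nonneg _).trans (h 0 (by simp))
  have hB := bernstein_ineq hn P hP M h
  have hax : |x| ≤ 1 := abs_le.mpr ⟨by linarith, hx⟩
  rcases le_total (znode n 0) x with hc | hc
  · have hd : (derivative P).degree < n := by
      rcases eq_or_ne P 0 with rfl | h0
      · simp
      · exact (degree_derivative_lt h0).trans_le (degree_le_of_natDegree_le hP)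
    have := schur_edge hn (derivative P) hd (M * n) hB hc hax
    linarith [this, (by ring : M * n * n = M * (n : ℝ) ^ 2)]
  · have hb := hB (Real.arccos x)
    rw [Real.cos_arccos (by linarith) hx] at hb
    have hs : 1 / (n : ℝ) ≤ Real.sin (Real.arccos x) := by
      have h1 : Real.pi / (2 * n) ≤ Real.arccos x := by
        have hm := zangle_mem hn
        have e : Real.arccos (znode n 0) = Real.pi / (2 * n) := by
          rw [znode, Real.arccos_cos hm.1.le hm.2.le]; simp
        rw [← e]; exact Real.arccos_le_arccos hc
      have h2 : Real.arccos x ≤ Real.pi / 2 := Real.arccos_le_pi_div_two.mpr hx0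
      have h3 := Real.mul_le_sin (Real.arccos_nonneg x) h2
      refine le_trans ?_ h3
      calc 1 / (n : ℝ) = 2 / Real.pi * (Real.pi / (2 * n)) := by
            have := Real.pi_pos.ne'
            field_simp
        _ ≤ _ := by have := Real.pi_pos; gcongr
    have hs0 : 0 < Real.sin (Real.arccos x) := lt_of_lt_of_le (by positivity) hs
    rw [abs_mul, abs_of_pos hs0] at hb
    have h5 : 1 / (n : ℝ) * |(derivative P).eval x| ≤ M * n :=
      (mul_le_mul_of_nonneg_right hs (abs_nonneg _)).trans hb
    rw [one_div, inv_mul_le_iff₀ hn'] at h5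
    linarith [(by ring : (n : ℝ) * (M * n) = M * (n : ℝ) ^ 2)]

open Polynomial in
lemma markov (P : ℝ[X]) (M : ℝ)
    (h : ∀ x, |x| ≤ 1 → |P.eval x| ≤ M) {x : ℝ} (hx : |x| ≤ 1) :
    |(derivative P).eval x| ≤ M * P.natDegree ^ 2 := by
  rcases Nat.eq_zero_or_pos P.natDegree with h0 | h0
  · rw [eq_C_of_natDegree_eq_zero h0]; simp
  have hx' := abs_le.mp hx
  rcases le_total 0 x with hx0 | hx0
  · exact markov_pos h0 P le_rfl M h hx0 hx'.2
  · have := markov_pos h0 (P.comp (-X)) (by rw [natDegree_comp]; simp) M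
      (fun y hy => by simpa using h (-y) (by simpa using hy)) (x := -x) (by linarith) (by linarith)
    simpa [derivative_comp] using this

open Polynomial

/-- (Ehlich–Zeller / Rivlin–Cheney) If a univariate real polynomial of degree `d`
satisfies `b₁ ≤ p(i) ≤ b₂` on the integers `0,…,n` and `|p'(x)| ≥ c > 0` for some
real `0 ≤ x ≤ n`, then `d ≥ √(cn/(c + b₂ − b₁))`. -/
theorem stmt7 (n : ℕ) (p : Polynomial ℝ) (b₁ b₂ c : ℝ) (hc : 0 < c)
    (hbound : ∀ i : ℕ, i ≤ n → b₁ ≤ p.eval (i : ℝ) ∧ p.eval (i : ℝ) ≤ b₂)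
    (x : ℝ) (hx0 : 0 ≤ x) (hxn : x ≤ n)
    (hderiv : c ≤ |(Polynomial.derivative p).eval x|) :
    Real.sqrt (c * n / (c + b₂ - b₁)) ≤ (p.natDegree : ℝ) := by
  rcases Nat.eq_zero_or_pos n with rfl | hn
  · simp
  have hn' : (0 : ℝ) < n := by exact_mod_cast hn
  have hb : b₁ ≤ b₂ := (hbound 0 (by omega)).1.trans (hbound 0 (by omega)).2
  obtain ⟨z, hz, hmax⟩ := (isCompact_Icc (a := (0 : ℝ)) (b := n)).exists_isMaxOn
    ⟨x, hx0, hxn⟩ (f := fun y : ℝ => |(derivative p).eval y|) (by fun_prop)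
  set D := |(derivative p).eval z| with hD
  have hmax' : ∀ y : ℝ, 0 ≤ y → y ≤ n → |(derivative p).eval y| ≤ D :=
    fun y h1 h2 => hmax ⟨h1, h2⟩
  have hcD : c ≤ D := hderiv.trans (hmax' x hx0 hxn)
  have hlip : ∀ u v : ℝ, u ∈ Set.Icc (0 : ℝ) n → v ∈ Set.Icc (0 : ℝ) n →
      |p.eval v - p.eval u| ≤ D * |v - u| := by
    intro u v hu hv
    have := (convex_Icc (0 : ℝ) n).norm_image_sub_le_of_norm_deriv_le
      (f := fun y => p.eval y) (C := D) (fun y _ => p.differentiableAt)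
      (fun y hy => by
        rw [Polynomial.deriv, Real.norm_eq_abs]; exact hmax' y hy.1 hy.2) hu hv
    simpa using this
  have hall : ∀ y : ℝ, 0 ≤ y → y ≤ n → |p.eval y - (b₁ + b₂) / 2| ≤ (b₂ - b₁ + D) / 2 := by
    intro y h1 h2
    have hr0 : (0 : ℤ) ≤ round y := by
      rw [round_eq]; apply Int.floor_nonneg.mpr; linarith
    have hrn : round y ≤ (n : ℤ) := by
      rw [round_eq, ← Int.lt_add_one_iff, Int.floor_lt]; push_cast; linarith
    obtain ⟨k, hk⟩ := Int.eq_ofNat_of_zero_le hr0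
    have hkn : k ≤ n := by omega
    have hr := abs_sub_round y
    rw [hk] at hr
    push_cast at hr
    have hkn' : (k : ℝ) ≤ n := by exact_mod_cast hkn
    have hl := hlip k y ⟨by positivity, hkn'⟩ ⟨h1, h2⟩
    have hl2 : |p.eval y - p.eval (k : ℝ)| ≤ D * (1 / 2) :=
      hl.trans (mul_le_mul_of_nonneg_left hr (abs_nonneg _))
    obtain ⟨g1, g2⟩ := hbound k hkn
    obtain ⟨g3, g4⟩ := abs_le.mp hl2
    rw [abs_le]; constructor <;> linarith
  have hL : (C ((n : ℝ) / 2) * X + C ((n : ℝ) / 2)).natDegree = 1 :=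
    natDegree_linear (by positivity)
  have hmk := markov ((p - C ((b₁ + b₂) / 2)).comp (C ((n : ℝ) / 2) * X + C ((n : ℝ) / 2)))
    ((b₂ - b₁ + D) / 2) (fun y hy => by
      obtain ⟨h1, h2⟩ := abs_le.mp hy
      have := hall (n / 2 * y + n / 2) (by nlinarith) (by nlinarith)
      simpa using this) (x := 2 * z / n - 1) (by
      rw [abs_le]
      have : 2 * z / n ≤ 2 := by rw [div_le_iff₀ hn']; linarith [hz.2]
      have : 0 ≤ 2 * z / n := by have := hz.1; positivity
      constructor <;> linarith)
  rw [natDegree_comp, hL, natDegree_sub_C, mul_one, derivative_comp] at hmk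
  have ez : (n : ℝ) / 2 * (2 * z / n - 1) + n / 2 = z := by field_simp; ring
  simp [ez, abs_mul] at hmk
  rw [← hD, abs_of_pos (by positivity)] at hmk
  apply Real.sqrt_le_iff.mpr
  refine ⟨by positivity, ?_⟩
  have hp : 0 < c + b₂ - b₁ := by linarith
  rw [div_le_iff₀ hp]
  have h1 : (n : ℝ) * D ≤ (b₂ - b₁ + D) * (p.natDegree : ℝ) ^ 2 := by linarith
  set d2 := (p.natDegree : ℝ) ^ 2
  have hd2 : 0 ≤ d2 := by positivity
  have hDp : 0 < D := hc.trans_le hcD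
  have h2 : c * n * D ≤ d2 * (c + b₂ - b₁) * D := by
    nlinarith [mul_nonneg (mul_nonneg hd2 (sub_nonneg.mpr hb)) (sub_nonneg.mpr hcD)]
  exact le_of_mul_le_mul_right h2 hDp
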